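/- Let ν = (ν_1 ≥ ⋯ ≥ ν_l > 0) be a partition with l parts. For each 1 ≤ i ≤ l, the multiset of hook lengths of the boxes in row i, {h(i, j) : 1 ≤ j ≤ ν_i}, equals the set {1, 2, …, ν_i + l − i} with the l − i elements {ν_i − ν_b + b − i : i < b ≤ l} removed (these elements are pairwise distinct and lie in {1, …, ν_i + l − i}). -/

import Mathlib

open scoped BigOperators

/-- The number of parts of size at least `c` exceeds `b` exactly when the part `ν b` is at least `c`:
conjugation exchanges the row and column conditions on a box. -/
theorem lt_card_filter_le_iff {l : ℕ} {ν : Fin l → ℕ} (hν : Antitone ν) (b : Fin l) (c : ℕ) :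
    b.1 < (Finset.univ.filter fun k : Fin l => c ≤ ν k).card ↔ c ≤ ν b := by
  constructor
  · contrapose!
    intro hb
    rw [← Fin.card_Iio b]
    refine Finset.card_le_card fun k hk => ?_
    rw [Finset.mem_filter] at hk
    rw [Finset.mem_Iio]
    by_contra! hbk
    exact absurd (hk.2.trans (hν hbk)) hb.not_ge
  · intro hb
    rw [← Nat.succ_le_iff, Nat.succ_eq_add_one, ← Fin.card_Iic b]
    refine Finset.card_le_card fun k hk => ?_
    rw [Finset.mem_Iic] at hk
    exact Finset.mem_filter.2 ⟨Finset.mem_univ k, hb.trans (hν hk)⟩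

theorem stmt8 (l : ℕ) (ν : Fin l → ℕ)
    (hmono : ∀ i j : Fin l, i ≤ j → ν j ≤ ν i) (hpos : ∀ i, 0 < ν i)
    -- the conjugate partition: ν'_c = #{rows i with ν_i ≥ c}
    (conj : ℕ → ℕ)
    (hconj : ∀ c, conj c = (Finset.univ.filter fun i : Fin l => c ≤ ν i).card)
    -- hook length of the box in (0-indexed) row i, (0-indexed) column j:
    -- h(i+1, j+1) = (ν_i − (j+1)) + (ν'_{j+1} − (i+1)) + 1
    (hk : Fin l → ℕ → ℕ)
    (hhk : ∀ (i : Fin l) (j : ℕ), hk i j = (ν i - (j + 1)) + (conj (j + 1) - (i.1 + 1)) + 1)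
    (i : Fin l)
    -- the multiset of elements removed: {ν_i − ν_b + b − i : i < b ≤ l} (1-indexed i, b)
    (removed : Multiset ℕ)
    (hremoved : removed =
      ((Finset.univ.filter fun b : Fin l => i < b).val).map
        (fun b => ν i - ν b + (b.1 + 1) - (i.1 + 1))) :
    (Multiset.range (ν i)).map (fun j => hk i j) =
        Multiset.Icc 1 (ν i + l - (i.1 + 1)) - removed ∧
      removed.Nodup ∧
      ∀ x ∈ removed, 1 ≤ x ∧ x ≤ ν i + l - (i.1 + 1) := by
  have hν : Antitone ν := fun a b hab => hmono a b hab
  have hconj_iff (b : Fin l) (c : ℕ) : b.1 < conj c ↔ c ≤ ν b := by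
    rw [hconj, lt_card_filter_le_iff hν]
  have hconj_anti : Antitone conj := fun c d hcd => by
    simp only [hconj]
    exact Finset.card_le_card (Finset.monotone_filter_right _ fun k _ hk => hcd.trans hk)
  have hconj_le (c : ℕ) : conj c ≤ l := by
    rw [hconj]
    exact (Finset.card_filter_le _ _).trans_eq (Finset.card_fin l)
  have hil := i.isLt
  have hνi := hpos i
  set f : Fin l → ℕ := fun b => ν i - ν b + (b.1 + 1) - (i.1 + 1) with hf
  have hhook_inj : Set.InjOn (hk i) (Finset.range (ν i)) := by
    refine StrictAntiOn.injOn fun j hj k hk' hjk => ?_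
    simp only [Finset.coe_range, Set.mem_Iio] at hj hk'
    have := (hconj_iff i (k + 1)).2 hk'
    have := hconj_anti (show j + 1 ≤ k + 1 by lia)
    rw [hhk, hhk]
    lia
  have hf_inj : Set.InjOn f (Finset.univ.filter fun b : Fin l => i < b) := by
    refine StrictMonoOn.injOn fun a ha b hb hab => ?_
    simp only [Finset.coe_filter, Finset.mem_univ, true_and, Set.mem_ofPred_eq] at ha hb
    have := hν hab.le
    have := hν ha.le
    simp only [hf]
    lia
  have hf_mem : ∀ b, i < b → 1 ≤ f b ∧ f b ≤ ν i + l - (i.1 + 1) := by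
    intro b hb
    have := hν hb.le
    have := hpos b
    have := b.isLt
    simp only [hf]
    lia
  have hhook_mem : ∀ j < ν i, 1 ≤ hk i j ∧ hk i j ≤ ν i + l - (i.1 + 1) := by
    intro j hj
    have := (hconj_iff i (j + 1)).2 hj
    have := hconj_le (j + 1)
    rw [hhk]
    lia
  have hne : ∀ j < ν i, ∀ b, i < b → hk i j ≠ f b := by
    intro j hj b hb
    have := (hconj_iff i (j + 1)).2 hj
    have := hconj_iff b (j + 1)
    have := hν hb.le
    rw [hhk]
    simp only [hf]
    lia
  set H := (Finset.range (ν i)).image (hk i) with hH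
  set R := (Finset.univ.filter fun b : Fin l => i < b).image f with hR
  have hR_val : removed = R.val := by
    rw [hremoved, hR, Finset.image_val_of_injOn hf_inj]
  have hH_val : (Multiset.range (ν i)).map (fun j => hk i j) = H.val := by
    rw [hH, Finset.image_val_of_injOn hhook_inj, Finset.range_val]
  have hR_sub : R ⊆ Finset.Icc 1 (ν i + l - (i.1 + 1)) := by
    simp only [hR, Finset.image_subset_iff, Finset.mem_filter_univ, Finset.mem_Icc]
    exact hf_mem
  have hH_sub : H ⊆ Finset.Icc 1 (ν i + l - (i.1 + 1)) \ R := by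
    simp only [hH, hR, Finset.image_subset_iff, Finset.mem_range, Finset.mem_sdiff,
      Finset.mem_Icc, Finset.mem_image, Finset.mem_filter_univ]
    exact fun j hj => ⟨hhook_mem j hj, fun ⟨b, hb, h⟩ => hne j hj b hb h.symm⟩
  have hH_eq : H = Finset.Icc 1 (ν i + l - (i.1 + 1)) \ R := by
    refine Finset.eq_of_subset_of_card_le hH_sub ?_
    have hIoi : (Finset.univ.filter fun b : Fin l => i < b) = Finset.Ioi i := by
      ext b
      simp
    rw [Finset.card_sdiff_of_subset hR_sub, Finset.card_image_of_injOn hhook_inj,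
      Finset.card_image_of_injOn hf_inj, hIoi, Fin.card_Ioi, Nat.card_Icc, Finset.card_range]
    lia
  refine ⟨?_, ?_, ?_⟩
  · rw [hH_val, hR_val, hH_eq, Finset.sdiff_val]
    rfl
  · rw [hR_val]
    exact R.nodup
  · intro x hx
    rw [hR_val] at hx
    exact Finset.mem_Icc.1 (hR_sub hx)
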